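/- Let f, g : (0,∞) → ℝ be convex with f(1) = g(1) = 0, and suppose the limits f(0), f*(0), g(0), g*(0) all exist as finite reals. Then every (f,g)-achievable point is a convex combination of two 2-achievable points: for every n and all probability vectors P, Q of length n there exist α ∈ [0,1] and probability vectors P₁, Q₁, P₂, Q₂ each of length 2 such that (D_f(P,Q), D_g(P,Q)) = (1−α)·(D_f(P₁,Q₁), D_g(P₁,Q₁)) + α·(D_f(P₂,Q₂), D_g(P₂,Q₂)). -/

import Mathlib

open Finset Filter Topology

/-- A probability vector of length `n`: nonnegative entries summing to 1. -/
def IsProbVec {n : ℕ} (P : Fin n → ℝ) : Prop :=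
  (∀ i, 0 ≤ P i) ∧ ∑ i, P i = 1

/-- The `f`-divergence of two probability vectors, where `f0` stands for the limit
`f(0) = lim_{t→0+} f(t)` and `fstar0` for `f*(0) = lim_{t→∞} f(t)/t`. -/
noncomputable def fDiv {n : ℕ} (f : ℝ → ℝ) (f0 fstar0 : ℝ) (P Q : Fin n → ℝ) : ℝ :=
  ∑ i, if 0 < Q i then Q i * (if 0 < P i then f (P i / Q i) else f0) else fstar0 * P i

/-- Perspective function of `f`, the summand of the divergence. -/
noncomputable def persp (f : ℝ → ℝ) (f0 fs p q : ℝ) : ℝ :=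
  if 0 < q then q * (if 0 < p then f (p / q) else f0) else fs * p

lemma persp_smul (f : ℝ → ℝ) (f0 fs c p q : ℝ) (hc : 0 ≤ c) :
    persp f f0 fs (c * p) (c * q) = c * persp f f0 fs p q := by
  unfold persp
  rcases hc.eq_or_lt with rfl | hc
  · simp
  · simp only [mul_pos_iff_of_pos_left hc]
    split_ifs
    · rw [mul_div_mul_left _ _ hc.ne']; ring
    · ring
    · ring

lemma persp_diag (f : ℝ → ℝ) (f0 fs p : ℝ) (hp : 0 ≤ p) (hf1 : f 1 = 0) :
    persp f f0 fs p p = 0 := by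
  unfold persp
  rcases hp.eq_or_lt with rfl | hp
  · simp
  · simp [hp, hp.ne', hf1]

lemma persp_cont (f : ℝ → ℝ) (f0 fs : ℝ) (hf : ConvexOn ℝ (Set.Ioi 0) f)
    (hf0 : Tendsto f (𝓝[>] (0:ℝ)) (𝓝 f0))
    (hfs : Tendsto (fun t => f t / t) atTop (𝓝 fs)) :
    ContinuousOn (fun u => persp f f0 fs u (1 - u)) (Set.Icc 0 1) := by
  have hc : ContinuousOn f (Set.Ioi 0) := hf.continuousOn isOpen_Ioi
  intro u hu
  rcases hu.1.eq_or_lt with rfl | h0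
  · have key : ContinuousWithinAt (fun u => persp f f0 fs u (1 - u)) (Set.Ioi 0) 0 := by
      have h1 : persp f f0 fs 0 (1 - 0) = f0 := by simp [persp]
      unfold ContinuousWithinAt
      simp only [h1]
      have e : ∀ᶠ u in 𝓝[>] (0:ℝ), (1 - u) * f (u / (1 - u)) = persp f f0 fs u (1 - u) := by
        have h2 : ∀ᶠ u in 𝓝[>] (0:ℝ), u < 1 :=
          nhdsWithin_le_nhds (Iio_mem_nhds (by norm_num))
        filter_upwards [h2, self_mem_nhdsWithin] with u hu1 hu0
        have : 0 < u := hu0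
        simp [persp, hu1, this]
      refine Tendsto.congr' e ?_
      have t1 : Tendsto (fun u : ℝ => u / (1 - u)) (𝓝[>] 0) (𝓝[>] 0) := by
        refine tendsto_nhdsWithin_iff.2 ⟨?_, ?_⟩
        · have : ContinuousAt (fun u : ℝ => u / (1 - u)) 0 :=
            continuousAt_id.div (by fun_prop) (by norm_num)
          have h := this.tendsto
          simp only [zero_div] at h
          exact h.mono_left nhdsWithin_le_nhds
        · have h2 : ∀ᶠ u in 𝓝[>] (0:ℝ), u < 1 :=
            nhdsWithin_le_nhds (Iio_mem_nhds (by norm_num))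
          filter_upwards [h2, self_mem_nhdsWithin] with u hu1 hu0
          have hu2 : 0 < u := hu0
          have hu3 : 0 < 1 - u := by linarith
          exact div_pos hu2 hu3
      have t2 : Tendsto (fun u : ℝ => 1 - u) (𝓝[>] 0) (𝓝 1) := by
        have : ContinuousAt (fun u : ℝ => 1 - u) 0 := by fun_prop
        have h := this.tendsto
        simp only [sub_zero] at h
        exact h.mono_left nhdsWithin_le_nhds
      simpa using t2.mul (hf0.comp t1)
    have k2 := continuousWithinAt_insert_self.2 key
    refine k2.mono ?_
    intro x hx
    rcases hx.1.eq_or_lt with h | h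
    · left; exact h.symm
    · right; exact h
  rcases hu.2.eq_or_lt with rfl | h1
  · have key : ContinuousWithinAt (fun u => persp f f0 fs u (1 - u)) (Set.Iio 1) 1 := by
      have h1 : persp f f0 fs 1 (1 - 1) = fs := by simp [persp]
      unfold ContinuousWithinAt
      simp only [h1]
      have e0 : ∀ᶠ u in 𝓝[<] (1:ℝ), 0 < u :=
          nhdsWithin_le_nhds (Ioi_mem_nhds (by norm_num))
      have e : ∀ᶠ u in 𝓝[<] (1:ℝ), u * (f (u / (1 - u)) / (u / (1 - u)))
          = persp f f0 fs u (1 - u) := by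
        filter_upwards [e0, self_mem_nhdsWithin] with u hu0 hu1
        have h3 : u < 1 := hu1
        have h4 : 1 - u ≠ 0 := by linarith
        simp only [persp, sub_pos, h3, hu0, if_true]
        field_simp
      refine Tendsto.congr' e ?_
      have t2 : Tendsto (fun u : ℝ => 1 - u) (𝓝[<] 1) (𝓝[>] 0) := by
        refine tendsto_nhdsWithin_iff.2 ⟨?_, ?_⟩
        · have : ContinuousAt (fun u : ℝ => 1 - u) 1 := by fun_prop
          have h := this.tendsto
          simp only [sub_self] at h
          exact h.mono_left nhdsWithin_le_nhds
        · filter_upwards [self_mem_nhdsWithin] with u hu1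
          have h3 : u < 1 := hu1
          exact sub_pos.2 h3
      have t3 : Tendsto (fun u : ℝ => u) (𝓝[<] 1) (𝓝 1) := nhdsWithin_le_nhds
      have t1 : Tendsto (fun u : ℝ => u / (1 - u)) (𝓝[<] 1) atTop := by
        simp only [div_eq_mul_inv]
        exact t3.pos_mul_atTop one_pos (tendsto_inv_nhdsGT_zero.comp t2)
      simpa using t3.mul (hfs.comp t1)
    have k2 := continuousWithinAt_insert_self.2 key
    refine k2.mono ?_
    intro x hx
    rcases hx.2.eq_or_lt with h | h
    · left; exact h
    · right; exact h
  · apply ContinuousAt.continuousWithinAt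
    have e : (fun u => (1 - u) * f (u / (1 - u))) =ᶠ[𝓝 u] fun u => persp f f0 fs u (1 - u) := by
      filter_upwards [Ioo_mem_nhds h0 h1] with v hv
      simp [persp, hv.1, hv.2]
    refine ContinuousAt.congr ?_ e
    have h2 : 1 - u ≠ 0 := by linarith
    have c1 : ContinuousAt (fun u : ℝ => u / (1 - u)) u :=
      continuousAt_id.div (by fun_prop) h2
    have c2 : ContinuousAt f (u / (1 - u)) :=
      hc.continuousAt (Ioi_mem_nhds (div_pos h0 (by linarith)))
    have c3 : ContinuousAt (fun u : ℝ => f (u / (1 - u))) u :=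
      ContinuousAt.comp (f := fun u : ℝ => u / (1 - u)) c2 c1
    exact ContinuousAt.mul (by fun_prop) c3

/-- Divergence of the two-point pair with likelihood parameters `z`. -/
noncomputable def twoPt (f : ℝ → ℝ) (f0 fs : ℝ) (z : ℝ × ℝ) : ℝ :=
  ((2 * z.2 - 1) * persp f f0 fs z.1 (1 - z.1)
    + (1 - 2 * z.1) * persp f f0 fs z.2 (1 - z.2)) / (z.2 - z.1)

/-- Parameter region. -/
def region : Set (ℝ × ℝ) := Set.Ico 0 (1/2) ×ˢ Set.Icc (1/2) 1

lemma twoPt_cont (f : ℝ → ℝ) (f0 fs : ℝ)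
    (h : ContinuousOn (fun u => persp f f0 fs u (1 - u)) (Set.Icc 0 1)) :
    ContinuousOn (twoPt f f0 fs) region := by
  unfold twoPt
  have h1 : ContinuousOn (fun z : ℝ × ℝ => persp f f0 fs z.1 (1 - z.1)) region :=
    h.comp (f := fun z : ℝ × ℝ => z.1) continuousOn_fst (by
      rintro ⟨a, b⟩ ⟨h1, h2⟩
      simp only [Set.mem_Ico, Set.mem_Icc] at *
      constructor <;> linarith)
  have h2 : ContinuousOn (fun z : ℝ × ℝ => persp f f0 fs z.2 (1 - z.2)) region :=
    h.comp (f := fun z : ℝ × ℝ => z.2) continuousOn_snd (by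
      rintro ⟨a, b⟩ ⟨h1, h2⟩
      simp only [Set.mem_Ico, Set.mem_Icc] at *
      constructor <;> linarith)
  refine ContinuousOn.div ?_ (by fun_prop) ?_
  · exact (ContinuousOn.mul (by fun_prop) h1).add (ContinuousOn.mul (by fun_prop) h2)
  · rintro ⟨a, b⟩ ⟨h1, h2⟩
    simp only [Set.mem_Ico, Set.mem_Icc] at *
    intro h; linarith

lemma twoPt_ach (z : ℝ × ℝ) (hz : z ∈ region) : ∃ P Q : Fin 2 → ℝ, IsProbVec P ∧ IsProbVec Q ∧
    ∀ (f : ℝ → ℝ) (f0 fs : ℝ), fDiv f f0 fs P Q = twoPt f f0 fs z := by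
  obtain ⟨a, b⟩ := z
  obtain ⟨⟨h1, h2⟩, h3, h4⟩ := hz
  simp only at h1 h2 h3 h4
  have hd : 0 < b - a := by linarith
  have hw1 : 0 ≤ (2 * b - 1) / (b - a) := div_nonneg (by linarith) hd.le
  have hw2 : 0 ≤ (1 - 2 * a) / (b - a) := div_nonneg (by linarith) hd.le
  refine ⟨![(2 * b - 1) / (b - a) * a, (1 - 2 * a) / (b - a) * b],
    ![(2 * b - 1) / (b - a) * (1 - a), (1 - 2 * a) / (b - a) * (1 - b)], ⟨?_, ?_⟩, ⟨?_, ?_⟩, ?_⟩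
  · intro i
    fin_cases i
    · exact mul_nonneg hw1 h1
    · exact mul_nonneg hw2 (by linarith)
  · simp only [Fin.sum_univ_two, Matrix.cons_val_zero, Matrix.cons_val_one]
    field_simp
    ring
  · intro i
    fin_cases i
    · exact mul_nonneg hw1 (by linarith)
    · exact mul_nonneg hw2 (by linarith)
  · simp only [Fin.sum_univ_two, Matrix.cons_val_zero, Matrix.cons_val_one]
    field_simp
    ring
  · intro f f0 fs
    have : ∀ P Q : Fin 2 → ℝ, fDiv f f0 fs P Q
      = persp f f0 fs (P 0) (Q 0) + persp f f0 fs (P 1) (Q 1) := fun P Q => Fin.sum_univ_two _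
    rw [this]
    simp only [Matrix.cons_val_zero, Matrix.cons_val_one, twoPt]
    rw [persp_smul _ _ _ _ _ _ hw1, persp_smul _ _ _ _ _ _ hw2]
    ring

/-- Normalised parameter. -/
noncomputable def par (p q : ℝ) : ℝ := if p + q = 0 then 1/2 else p / (p + q)

lemma pair_eq (f : ℝ → ℝ) (f0 fs p q r s : ℝ) (hp : 0 ≤ p) (hpq : p < q)
    (hs : 0 ≤ s) (hrs : s ≤ r) :
    (r * q - p * s) * twoPt f f0 fs (par p q, par r s)
      = (r - s) * persp f f0 fs p q + (q - p) * persp f f0 fs r s := by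
  have hA : 0 < p + q := by linarith
  rcases (by linarith : 0 ≤ r + s).eq_or_lt with h | hB
  · have hr : r = 0 := by linarith
    have hs' : s = 0 := by linarith
    subst hr hs'
    simp [persp]
  · have e1 : par p q = p / (p + q) := by simp [par, hA.ne']
    have e2 : par r s = r / (r + s) := by simp [par, hB.ne']
    have f1 : persp f f0 fs p q = (p + q) * persp f f0 fs (par p q) (1 - par p q) := by
      rw [← persp_smul _ _ _ _ _ _ hA.le, e1]
      congr 1 <;> field_simp <;> ring
    have f2 : persp f f0 fs r s = (r + s) * persp f f0 fs (par r s) (1 - par r s) := by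
      rw [← persp_smul _ _ _ _ _ _ hB.le, e2]
      congr 1 <;> field_simp <;> ring
    rw [f1, f2]
    simp only [twoPt]
    generalize persp f f0 fs (par p q) (1 - par p q) = x
    generalize persp f f0 fs (par r s) (1 - par r s) = y
    rw [e1, e2]
    have hr : 0 < r := by linarith
    have hd : 0 < r * q - p * s := by nlinarith [mul_pos hr (sub_pos.2 hpq), mul_nonneg hp (sub_nonneg.2 hrs)]
    have e3 : r / (r + s) - p / (p + q) = (r * q - p * s) / ((p + q) * (r + s)) := by
      field_simp; ring
    rw [e3]
    field_simp
    ring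

lemma par_region (p q r s : ℝ) (hp : 0 ≤ p) (hpq : p < q)
    (hs : 0 ≤ s) (hrs : s ≤ r) : (par p q, par r s) ∈ region := by
  have hA : 0 < p + q := by linarith
  refine ⟨?_, ?_⟩
  · simp only [par, hA.ne', if_false]
    exact ⟨by positivity, by rw [div_lt_div_iff₀ hA two_pos]; linarith⟩
  · simp only [par]
    split_ifs with h
    · constructor <;> norm_num
    · have hB : 0 < r + s := lt_of_le_of_ne (by linarith) (Ne.symm h)
      exact ⟨by rw [div_le_div_iff₀ two_pos hB]; linarith, by rw [div_le_one hB]; linarith⟩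

lemma mem_hull (f g : ℝ → ℝ) (f0 fs g0 gs : ℝ) (hf1 : f 1 = 0) (hg1 : g 1 = 0)
    (n : ℕ) (P Q : Fin n → ℝ) (hP : IsProbVec P) (hQ : IsProbVec Q) :
    ((fDiv f f0 fs P Q, fDiv g g0 gs P Q) : ℝ × ℝ) ∈
      convexHull ℝ ((fun z => (twoPt f f0 fs z, twoPt g g0 gs z)) '' region) := by
  classical
  set L := Finset.univ.filter (fun i => P i < Q i) with hL
  set R := Finset.univ.filter (fun i => ¬ P i < Q i) with hR
  have split : ∀ F : Fin n → ℝ, ∑ i ∈ L, F i + ∑ i ∈ R, F i = ∑ i, F i := fun F =>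
    Finset.sum_filter_add_sum_filter_not _ _ _
  have hLm : ∀ i ∈ L, P i < Q i := fun i hi => (Finset.mem_filter.1 hi).2
  have hRm : ∀ i ∈ R, Q i ≤ P i := fun i hi => not_lt.1 (Finset.mem_filter.1 hi).2
  have sP := split P
  have sQ := split Q
  rw [hP.2] at sP
  rw [hQ.2] at sQ
  set m := ∑ i ∈ L, (Q i - P i) with hm
  have hm' : m = ∑ i ∈ L, Q i - ∑ i ∈ L, P i := Finset.sum_sub_distrib _ _
  have hmR : m = ∑ i ∈ R, (P i - Q i) := by
    rw [Finset.sum_sub_distrib]; linarith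
  have hm0 : 0 ≤ m := Finset.sum_nonneg fun i hi => by linarith [hLm i hi]
  rcases hm0.eq_or_lt with h | hmpos
  · have hd : ∀ i, P i = Q i := by
      intro i
      have a1 := (Finset.sum_eq_zero_iff_of_nonneg
        (fun i hi => by linarith [hLm i hi] : ∀ i ∈ L, 0 ≤ Q i - P i)).1 h.symm i
      have a2 := (Finset.sum_eq_zero_iff_of_nonneg
        (fun i hi => by linarith [hRm i hi] : ∀ i ∈ R, 0 ≤ P i - Q i)).1
        (hmR.symm.trans h.symm) i
      by_cases hi : P i < Q i
      · linarith [a1 (by simp [hL, hi])]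
      · have := a2 (by simp only [hR, Finset.mem_filter, Finset.mem_univ, true_and]; exact hi)
        linarith
    have z : ∀ (f : ℝ → ℝ) (f0 fs : ℝ), f 1 = 0 → fDiv f f0 fs P Q = 0 := by
      intro f f0 fs hf
      refine Finset.sum_eq_zero fun i _ => ?_
      rw [← hd i]
      exact persp_diag f f0 fs (P i) (hP.1 i) hf
    have z2 : ∀ (f : ℝ → ℝ) (f0 fs : ℝ), f 1 = 0 → twoPt f f0 fs (0, 1/2) = 0 := by
      intro f f0 fs hf
      have := persp_diag f f0 fs (1/2) (by norm_num) hf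
      have e : (1 : ℝ) - 1/2 = 1/2 := by norm_num
      simp only [twoPt, e, this]
      norm_num
    apply subset_convexHull
    refine ⟨(0, 1/2), by constructor <;> constructor <;> norm_num, ?_⟩
    simp only [z f f0 fs hf1, z g g0 gs hg1, z2 f f0 fs hf1, z2 g g0 gs hg1]
  · have key : ∀ (f : ℝ → ℝ) (f0 fs : ℝ), fDiv f f0 fs P Q = ∑ x ∈ L ×ˢ R,
        (P x.2 * Q x.1 - P x.1 * Q x.2) / m *
          twoPt f f0 fs (par (P x.1) (Q x.1), par (P x.2) (Q x.2)) := by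
      intro f f0 fs
      have e1 : fDiv f f0 fs P Q = ∑ i, persp f f0 fs (P i) (Q i) := rfl
      have e2 : ∀ x ∈ L ×ˢ R, (P x.2 * Q x.1 - P x.1 * Q x.2) / m *
          twoPt f f0 fs (par (P x.1) (Q x.1), par (P x.2) (Q x.2))
          = persp f f0 fs (P x.1) (Q x.1) * ((P x.2 - Q x.2) / m)
            + ((Q x.1 - P x.1) / m) * persp f f0 fs (P x.2) (Q x.2) := by
        intro x hx
        obtain ⟨hx1, hx2⟩ := Finset.mem_product.1 hx
        rw [div_mul_eq_mul_div, pair_eq _ _ _ _ _ _ _ (hP.1 _) (hLm _ hx1) (hQ.1 _) (hRm _ hx2)]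
        ring
      rw [Finset.sum_congr rfl e2, Finset.sum_add_distrib, e1, ← split]
      congr 1
      · rw [← Finset.sum_mul_sum L R (fun i => persp f f0 fs (P i) (Q i)) (fun j => (P j - Q j) / m) |>.trans (Finset.sum_product' _ _ _).symm, ← Finset.sum_div, ← hmR, div_self hmpos.ne', mul_one]
      · rw [← Finset.sum_mul_sum L R (fun i => (Q i - P i) / m) (fun j => persp f f0 fs (P j) (Q j)) |>.trans (Finset.sum_product' _ _ _).symm, ← Finset.sum_div, ← hm, div_self hmpos.ne', one_mul]
    have hw : ∑ x ∈ L ×ˢ R, (P x.2 * Q x.1 - P x.1 * Q x.2) / m = 1 := by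
      rw [← Finset.sum_div, div_eq_one_iff_eq hmpos.ne', Finset.sum_sub_distrib,
        Finset.sum_product, Finset.sum_product]
      simp only [← Finset.sum_mul, ← Finset.mul_sum]
      rw [hm']
      have e1 : ∑ i ∈ R, P i = 1 - ∑ i ∈ L, P i := by linarith
      have e2 : ∑ i ∈ R, Q i = 1 - ∑ i ∈ L, Q i := by linarith
      rw [e1, e2]
      ring
    have := (convex_convexHull ℝ ((fun z => (twoPt f f0 fs z, twoPt g g0 gs z)) '' region)).sum_mem
      (t := L ×ˢ R) (w := fun x => (P x.2 * Q x.1 - P x.1 * Q x.2) / m)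
      (z := fun x => (twoPt f f0 fs (par (P x.1) (Q x.1), par (P x.2) (Q x.2)),
        twoPt g g0 gs (par (P x.1) (Q x.1), par (P x.2) (Q x.2)))) ?_ hw ?_
    · convert this using 1
      rw [key f, key g]
      ext
      · simp [Prod.fst_sum]
      · simp [Prod.snd_sum]
    · intro x hx
      obtain ⟨hx1, hx2⟩ := Finset.mem_product.1 hx
      refine div_nonneg ?_ hm0
      have a1 := hP.1 x.1
      have a2 := hQ.1 x.2
      have a3 := hLm _ hx1
      have a4 := hRm _ hx2
      nlinarith [mul_nonneg a1 (sub_nonneg.2 a4),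
        mul_nonneg (a2.trans a4) (sub_nonneg.2 a3.le)]
    · intro x hx
      obtain ⟨hx1, hx2⟩ := Finset.mem_product.1 hx
      apply subset_convexHull
      exact ⟨_, par_region _ _ _ _ (hP.1 _) (hLm _ hx1) (hQ.1 _) (hRm _ hx2), rfl⟩

lemma seg_of (x v b : ℝ × ℝ) (y : ℝ) (hy : 0 ≤ y) (h1 : v.1 - x.1 = -y * (b.1 - x.1))
    (h2 : v.2 - x.2 = -y * (b.2 - x.2)) : x ∈ segment ℝ v b := by
  refine ⟨1 / (1 + y), y / (1 + y), by positivity, by positivity, by field_simp, ?_⟩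
  have e1 : v.1 = x.1 + -y * (b.1 - x.1) := by linarith
  have e2 : v.2 = x.2 + -y * (b.2 - x.2) := by linarith
  ext
  · simp only [Prod.fst_add, Prod.smul_fst, smul_eq_mul, e1]
    field_simp; ring
  · simp only [Prod.snd_add, Prod.smul_snd, smul_eq_mul, e2]
    field_simp; ring

lemma three_pt (S : Set (ℝ × ℝ)) (hS : IsPreconnected S) (x a b c : ℝ × ℝ)
    (ha : a ∈ S) (hb : b ∈ S) (hc : c ∈ S) (α β γ : ℝ) (hα : 0 < α) (hβ : 0 < β) (hγ : 0 < γ)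
    (h1 : α * (a.1 - x.1) + β * (b.1 - x.1) + γ * (c.1 - x.1) = 0)
    (h2 : α * (a.2 - x.2) + β * (b.2 - x.2) + γ * (c.2 - x.2) = 0) :
    ∃ u ∈ S, ∃ v ∈ S, x ∈ segment ℝ u v := by
  by_contra hcon
  push Not at hcon
  obtain ⟨D, hD⟩ : ∃ D, D = (a.1 - x.1) * (b.2 - x.2) - (a.2 - x.2) * (b.1 - x.1) := ⟨_, rfl⟩
  have hax : ¬ (a.1 - x.1 = 0 ∧ a.2 - x.2 = 0) := by
    rintro ⟨e1, e2⟩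
    exact hcon a ha a ha (seg_of _ _ _ 0 le_rfl (by rw [e1]; ring) (by rw [e2]; ring))
  by_cases hD0 : D = 0
  · -- `b - x = k (a - x)`
    obtain ⟨k, hk1, hk2⟩ : ∃ k, b.1 - x.1 = k * (a.1 - x.1) ∧ b.2 - x.2 = k * (a.2 - x.2) := by
      by_cases e : a.1 - x.1 = 0
      · have e2 : a.2 - x.2 ≠ 0 := fun h => hax ⟨e, h⟩
        refine ⟨(b.2 - x.2) / (a.2 - x.2), ?_, by field_simp⟩
        rw [e, mul_zero]
        have : (a.2 - x.2) * (b.1 - x.1) = 0 := by rw [e] at hD; linarith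
        exact (mul_eq_zero.1 this).resolve_left e2
      · refine ⟨(b.1 - x.1) / (a.1 - x.1), by field_simp, ?_⟩
        field_simp
        linarith
    rcases le_total k 0 with hk | hk
    · exact hcon b hb a ha (seg_of _ _ _ (-k) (by linarith) (by rw [hk1]; ring) (by rw [hk2]; ring))
    · refine hcon c hc a ha (seg_of _ _ _ ((α + β * k) / γ) (by positivity) ?_ ?_)
      · rw [hk1] at h1
        field_simp
        linarith
      · rw [hk2] at h2
        field_simp
        linarith
  -- cone coordinates of `-(v - x)` in the basis `a - x`, `b - x`
  obtain ⟨X, hX⟩ : ∃ X : ℝ × ℝ → ℝ, X = fun v =>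
    -((v.1 - x.1) * (b.2 - x.2) - (v.2 - x.2) * (b.1 - x.1)) / D := ⟨_, rfl⟩
  obtain ⟨Y, hY⟩ : ∃ Y : ℝ × ℝ → ℝ, Y = fun v =>
    -((a.1 - x.1) * (v.2 - x.2) - (a.2 - x.2) * (v.1 - x.1)) / D := ⟨_, rfl⟩
  have hXc : Continuous X := by rw [hX]; fun_prop
  have hYc : Continuous Y := by rw [hY]; fun_prop
  have r1 : ∀ v, v.1 - x.1 = -(X v) * (a.1 - x.1) + -(Y v) * (b.1 - x.1) := by
    intro v
    rw [hX, hY]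
    field_simp
    rw [hD]
    ring
  have r2 : ∀ v, v.2 - x.2 = -(X v) * (a.2 - x.2) + -(Y v) * (b.2 - x.2) := by
    intro v
    rw [hX, hY]
    field_simp
    rw [hD]
    ring
  have hcov : S ⊆ {v | 0 < X v ∧ 0 < Y v} ∪ {v | X v < 0 ∨ Y v < 0} := by
    intro v hv
    by_contra hn
    simp only [Set.mem_union, Set.mem_setOf_eq, not_or, not_and, not_lt] at hn
    obtain ⟨n1, n2, n3⟩ := hn
    rcases n2.eq_or_lt with h | h
    · exact hcon v hv b hb (seg_of _ _ _ (Y v) n3 (by rw [r1 v, ← h]; ring)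
        (by rw [r2 v, ← h]; ring))
    · have : Y v = 0 := le_antisymm (n1 h) n3
      exact hcon v hv a ha (seg_of _ _ _ (X v) n2 (by rw [r1 v, this]; ring)
        (by rw [r2 v, this]; ring))
  have hXa : X a = -1 := by
    rw [hX]
    simp only
    rw [← hD]
    field_simp
  have c1 : c.1 - x.1 = -(α * (a.1 - x.1) + β * (b.1 - x.1)) / γ := by
    field_simp; linarith
  have c2 : c.2 - x.2 = -(α * (a.2 - x.2) + β * (b.2 - x.2)) / γ := by
    field_simp; linarith
  have hXcv : X c = α / γ := by
    rw [hX]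
    simp only
    rw [c1, c2]
    field_simp
    rw [hD]
    ring
  have hYcv : Y c = β / γ := by
    rw [hY]
    simp only
    rw [c1, c2]
    field_simp
    rw [hD]
    ring
  obtain ⟨v, -, ⟨p1, p2⟩, p3⟩ := hS {v | 0 < X v ∧ 0 < Y v} {v | X v < 0 ∨ Y v < 0}
    ((isOpen_lt continuous_const hXc).inter (isOpen_lt continuous_const hYc))
    ((isOpen_lt hXc continuous_const).union (isOpen_lt hYc continuous_const)) hcov
    ⟨c, hc, by rw [Set.mem_setOf_eq, hXcv, hYcv]; constructor <;> positivity⟩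
    ⟨a, ha, by left; rw [hXa]; norm_num⟩
  rcases p3 with p3 | p3 <;> linarith

/-- Fenchel–Bunt in the plane. -/
lemma fenchel_bunt (S : Set (ℝ × ℝ)) (hS : IsPreconnected S) (x : ℝ × ℝ)
    (hx : x ∈ convexHull ℝ S) : ∃ u ∈ S, ∃ v ∈ S, x ∈ segment ℝ u v := by
  obtain ⟨ι, hι, z, w, hz, hai, hw, hw1, hsum⟩ := eq_pos_convex_span_of_mem_convexHull hx
  have hcard : Fintype.card ι ≤ 3 := by
    have := hai.card_le_finrank_succ
    have h2 := Submodule.finrank_le (vectorSpan ℝ (Set.range z))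
    have h3 : Module.finrank ℝ (ℝ × ℝ) = 2 := by simp
    omega
  obtain ⟨k, hk⟩ : ∃ k, Fintype.card ι = k := ⟨_, rfl⟩
  let e := (Fintype.equivFinOfCardEq hk).symm
  rw [← e.sum_comp] at hw1 hsum
  have hz' : ∀ i, z (e i) ∈ S := fun i => hz ⟨_, rfl⟩
  have hw' : ∀ i, 0 < w (e i) := fun i => hw _
  generalize hW : (fun i => w (e i)) = W at *
  generalize hZ : (fun i => z (e i)) = Z at *
  have hW2 : ∀ i, w (e i) = W i := fun i => congrFun hW i
  have hZ2 : ∀ i, z (e i) = Z i := fun i => congrFun hZ i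
  simp only [hW2, hZ2] at hw1 hsum hz' hw'
  clear hW hZ hW2 hZ2
  rw [hk] at hcard
  clear_value e
  clear e
  interval_cases k
  · simp at hw1
  · simp at hw1 hsum
    rw [hw1, one_smul] at hsum
    exact ⟨_, hz' 0, _, hz' 0, by rw [hsum]; exact left_mem_segment ℝ _ _⟩
  · rw [Fin.sum_univ_two] at hw1 hsum
    exact ⟨_, hz' 0, _, hz' 1, _, _, (hw' 0).le, (hw' 1).le, hw1, hsum⟩
  · rw [Fin.sum_univ_three] at hw1 hsum
    refine three_pt S hS x _ _ _ (hz' 0) (hz' 1) (hz' 2) _ _ _ (hw' 0) (hw' 1) (hw' 2) ?_ ?_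
    · rw [← hsum]
      simp only [Prod.fst_add, Prod.smul_fst, smul_eq_mul]
      have : W 0 = 1 - W 1 - W 2 := by linarith
      rw [this]; ring
    · rw [← hsum]
      simp only [Prod.snd_add, Prod.smul_snd, smul_eq_mul]
      have : W 0 = 1 - W 1 - W 2 := by linarith
      rw [this]; ring

/-- Every `(f,g)`-achievable point is a convex combination of two `2`-achievable points. -/
theorem achievable_convex_combination_of_two_achievable (f g : ℝ → ℝ) (f0 fstar0 g0 gstar0 : ℝ)
    (hf : ConvexOn ℝ (Set.Ioi 0) f) (hf1 : f 1 = 0)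
    (hg : ConvexOn ℝ (Set.Ioi 0) g) (hg1 : g 1 = 0)
    (hf0 : Tendsto f (𝓝[>] (0:ℝ)) (𝓝 f0))
    (hfs : Tendsto (fun t => f t / t) atTop (𝓝 fstar0))
    (hg0 : Tendsto g (𝓝[>] (0:ℝ)) (𝓝 g0))
    (hgs : Tendsto (fun t => g t / t) atTop (𝓝 gstar0))
    (n : ℕ) (P Q : Fin n → ℝ) (hP : IsProbVec P) (hQ : IsProbVec Q) :
    ∃ α ∈ Set.Icc (0:ℝ) 1, ∃ P₁ Q₁ P₂ Q₂ : Fin 2 → ℝ,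
      IsProbVec P₁ ∧ IsProbVec Q₁ ∧ IsProbVec P₂ ∧ IsProbVec Q₂ ∧
      ((fDiv f f0 fstar0 P Q, fDiv g g0 gstar0 P Q) : ℝ × ℝ)
        = (1 - α) • ((fDiv f f0 fstar0 P₁ Q₁, fDiv g g0 gstar0 P₁ Q₁) : ℝ × ℝ)
          + α • ((fDiv f f0 fstar0 P₂ Q₂, fDiv g g0 gstar0 P₂ Q₂) : ℝ × ℝ) := by
  have hS : IsPreconnected ((fun z => (twoPt f f0 fstar0 z, twoPt g g0 gstar0 z)) '' region) := by
    apply IsPreconnected.image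
    · exact ((convex_Ico (𝕜 := ℝ) _ _).prod (convex_Icc _ _)).isPreconnected
    · exact (twoPt_cont _ _ _ (persp_cont f f0 fstar0 hf hf0 hfs)).prodMk
        (twoPt_cont _ _ _ (persp_cont g g0 gstar0 hg hg0 hgs))
  obtain ⟨_, ⟨z1, hz1, rfl⟩, _, ⟨z2, hz2, rfl⟩, s, t, hs, ht, hst, h⟩ := fenchel_bunt _ hS _
    (mem_hull f g f0 fstar0 g0 gstar0 hf1 hg1 n P Q hP hQ)
  obtain ⟨P₁, Q₁, hP₁, hQ₁, h₁⟩ := twoPt_ach z1 hz1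
  obtain ⟨P₂, Q₂, hP₂, hQ₂, h₂⟩ := twoPt_ach z2 hz2
  refine ⟨t, ⟨ht, by linarith⟩, P₁, Q₁, P₂, Q₂, hP₁, hQ₁, hP₂, hQ₂, ?_⟩
  have hs' : s = 1 - t := by linarith
  rw [h₁, h₁, h₂, h₂, ← hs', h]
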